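/- Let T be a locally finite leafless ℝ-tree with at least three ends, and let G be a group of isometries of T whose induced action on ∂∞T is two-transitive (transitive on ordered pairs of distinct ends). Then T has exactly one branch point if and only if the set of ends ∂∞T is finite. -/

import Mathlib

/-- `s` is a geodesic segment joining `x` to `y`: the image of an isometric embedding of a
compact real interval, with endpoints `x` and `y`. -/
def IsGeodesicSegmentBetween {X : Type*} [MetricSpace X] (s : Set X) (x y : X) : Prop :=
  ∃ (γ : ℝ → X) (b : ℝ), 0 ≤ b ∧
    (∀ u ∈ Set.Icc (0 : ℝ) b, ∀ v ∈ Set.Icc (0 : ℝ) b, dist (γ u) (γ v) = |u - v|) ∧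
    γ 0 = x ∧ γ b = y ∧ s = γ '' Set.Icc 0 b

/-- `s` is a geodesic segment. -/
def IsGeodesicSegment {X : Type*} [MetricSpace X] (s : Set X) : Prop :=
  ∃ x y : X, IsGeodesicSegmentBetween s x y

/-- An ℝ-tree: any two points are joined by a unique geodesic segment, and if two geodesic
segments meet exactly in a common endpoint then their union is a geodesic segment. -/
def IsRTree (X : Type*) [MetricSpace X] : Prop :=
  (∀ x y : X, ∃! s : Set X, IsGeodesicSegmentBetween s x y) ∧
  (∀ (s t : Set X) (x y z : X), IsGeodesicSegmentBetween s x y →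
    IsGeodesicSegmentBetween t y z → s ∩ t = {y} → IsGeodesicSegmentBetween (s ∪ t) x z)

/-- `X` is leafless: every geodesic segment is contained in a strictly larger geodesic segment
extending it beyond each endpoint. -/
def Leafless (X : Type*) [MetricSpace X] : Prop :=
  ∀ (x y : X) (s : Set X), IsGeodesicSegmentBetween s x y →
    ∃ (x' y' : X) (s' : Set X), IsGeodesicSegmentBetween s' x' y' ∧ s ⊆ s' ∧
      0 < dist x' x ∧ 0 < dist y y' ∧ dist x' y' = dist x' x + dist x y + dist y y'

/-- A ray: the image of an isometric embedding of `[0, ∞)`. -/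
def IsRay {X : Type*} [MetricSpace X] (R : Set X) : Prop :=
  ∃ γ : ℝ → X, (∀ u ∈ Set.Ici (0 : ℝ), ∀ v ∈ Set.Ici (0 : ℝ), dist (γ u) (γ v) = |u - v|) ∧
    R = γ '' Set.Ici 0

/-- A ray starting at the point `x`. -/
def IsRayFrom {X : Type*} [MetricSpace X] (x : X) (R : Set X) : Prop :=
  ∃ γ : ℝ → X, (∀ u ∈ Set.Ici (0 : ℝ), ∀ v ∈ Set.Ici (0 : ℝ), dist (γ u) (γ v) = |u - v|) ∧
    γ 0 = x ∧ R = γ '' Set.Ici 0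

/-- An end of `X`, regarded as the set of all rays equivalent to a given ray (two rays are
equivalent when their intersection is a ray). -/
def IsEnd {X : Type*} [MetricSpace X] (e : Set (Set X)) : Prop :=
  ∃ R : Set X, IsRay R ∧ e = {R' : Set X | IsRay R' ∧ IsRay (R' ∩ R)}

/-- The action of a map on ends (as sets of rays), by pushing every ray forward. -/
def pushEnd {X Y : Type*} (φ : X → Y) (e : Set (Set X)) : Set (Set Y) :=
  (Set.image φ) '' e

/-- Two rays starting at `x` locally coincide: their intersection contains more than `x`. -/
def LocCoincide {X : Type*} [MetricSpace X] (x : X) (R R' : Set X) : Prop :=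
  ∃ p, p ∈ R ∩ R' ∧ p ≠ x

/-- `x` is a branch point: the valency of `x` (number of directions at `x`, i.e. classes of
rays from `x` up to local coincidence) is at least `3`. -/
def IsBranchPoint {X : Type*} [MetricSpace X] (x : X) : Prop :=
  ∃ R₁ R₂ R₃ : Set X, IsRayFrom x R₁ ∧ IsRayFrom x R₂ ∧ IsRayFrom x R₃ ∧
    ¬ LocCoincide x R₁ R₂ ∧ ¬ LocCoincide x R₁ R₃ ∧ ¬ LocCoincide x R₂ R₃

/-- `X` is locally finite: every point has finite valency, i.e. finitely many directions. -/
def LocallyFiniteTree (X : Type*) [MetricSpace X] : Prop :=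
  ∀ x : X, ∃ (n : ℕ) (Rs : Fin n → Set X), (∀ i, IsRayFrom x (Rs i)) ∧
    ∀ R : Set X, IsRayFrom x R → ∃ i, LocCoincide x R (Rs i)

/-- `X` admits at least three ends. -/
def AtLeastThreeEnds (X : Type*) [MetricSpace X] : Prop :=
  ∃ e₁ e₂ e₃ : Set (Set X), IsEnd e₁ ∧ IsEnd e₂ ∧ IsEnd e₃ ∧ e₁ ≠ e₂ ∧ e₁ ≠ e₃ ∧ e₂ ≠ e₃

/-- `fbar : X → Y` induces the map `f` on ends: every ray lying in an end `e` is sent to a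
ray lying in the end `f e`. -/
def Induces {X Y : Type*} [MetricSpace X] [MetricSpace Y]
    (fbar : X → Y) (f : Set (Set X) → Set (Set Y)) : Prop :=
  ∀ e : Set (Set X), IsEnd e → ∀ R ∈ e, fbar '' R ∈ f e

section RTree

variable {X : Type*} [MetricSpace X]

theorem IsGeodesicSegmentBetween.dist_add {s : Set X} {x y p : X}
    (hs : IsGeodesicSegmentBetween s x y) (hp : p ∈ s) :
    dist x p + dist p y = dist x y := by
  obtain ⟨γ, b, hb, hγ, rfl, rfl, rfl⟩ := hs
  obtain ⟨u, hu, rfl⟩ := hp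
  rw [hγ 0 ⟨le_rfl, hb⟩ u hu, hγ u hu b ⟨hb, le_rfl⟩, hγ 0 ⟨le_rfl, hb⟩ b ⟨hb, le_rfl⟩,
    abs_of_nonpos (by linarith [hu.1]), abs_of_nonpos (by linarith [hu.2]),
    abs_of_nonpos (by linarith)]
  ring

theorem IsGeodesicSegmentBetween.left_mem {s : Set X} {x y : X}
    (hs : IsGeodesicSegmentBetween s x y) : x ∈ s := by
  obtain ⟨γ, b, hb, hγ, rfl, rfl, rfl⟩ := hs
  exact ⟨0, ⟨le_rfl, hb⟩, rfl⟩

theorem IsGeodesicSegmentBetween.right_mem {s : Set X} {x y : X}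
    (hs : IsGeodesicSegmentBetween s x y) : y ∈ s := by
  obtain ⟨γ, b, hb, hγ, rfl, rfl, rfl⟩ := hs
  exact ⟨b, ⟨hb, le_rfl⟩, rfl⟩

theorem IsRTree.exists_param (h : IsRTree X) (x y : X) :
    ∃ γ : ℝ → X, γ 0 = x ∧ γ (dist x y) = y ∧
      ∀ u ∈ Set.Icc 0 (dist x y), ∀ v ∈ Set.Icc 0 (dist x y), dist (γ u) (γ v) = |u - v| := by
  obtain ⟨s, ⟨γ, b, hb, hγ, h0, h1, -⟩, -⟩ := h.1 x y
  have hd : dist x y = b := by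
    rw [← h0, ← h1, hγ 0 ⟨le_rfl, hb⟩ b ⟨hb, le_rfl⟩, abs_of_nonpos (by linarith)]; ring
  rw [hd]
  exact ⟨γ, h0, h1, hγ⟩

/-- A point lying metrically between `x` and `y` is determined by its distance to `x`. -/
theorem IsRTree.eq_of_between (h : IsRTree X) {x y p q : X}
    (hp : dist x p + dist p y = dist x y) (hq : dist x q + dist q y = dist x y)
    (hpq : dist x p = dist x q) : p = q := by
  obtain ⟨S, hS, huniq⟩ := h.1 x y
  have key : ∀ p, dist x p + dist p y = dist x y → p ∈ S := by
    intro p hp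
    obtain ⟨s, hs, -⟩ := h.1 x p
    obtain ⟨t, ht, -⟩ := h.1 p y
    have hst : s ∩ t = {p} := by
      ext w
      constructor
      · rintro ⟨h1, h2⟩
        have e1 := hs.dist_add h1
        have e2 := ht.dist_add h2
        have := dist_triangle x w y
        have := dist_comm w p
        exact dist_le_zero.1 (by linarith [@dist_nonneg _ _ w p])
      · rintro rfl
        exact ⟨hs.right_mem, ht.left_mem⟩
    rw [← huniq _ (h.2 s t x p y hs ht hst)]
    exact Or.inl hs.right_mem
  have hpS := key p hp
  have hqS := key q hq
  obtain ⟨γ, b, hb, hγ, rfl, rfl, rfl⟩ := hS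
  obtain ⟨u, hu, rfl⟩ := hpS
  obtain ⟨v, hv, rfl⟩ := hqS
  rw [hγ 0 ⟨le_rfl, hb⟩ u hu, hγ 0 ⟨le_rfl, hb⟩ v hv,
    abs_of_nonpos (by linarith [hu.1]), abs_of_nonpos (by linarith [hv.1])] at hpq
  rw [show u = v by linarith]

theorem exists_last_agreement {γ δ : ℝ → X} {b : ℝ} (hb : 0 ≤ b)
    (hγ : ∀ u ∈ Set.Icc 0 b, ∀ v ∈ Set.Icc 0 b, dist (γ u) (γ v) = |u - v|)
    (hδ : ∀ u ∈ Set.Icc 0 b, ∀ v ∈ Set.Icc 0 b, dist (δ u) (δ v) = |u - v|)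
    (h0 : γ 0 = δ 0) :
    ∃ t ∈ Set.Icc 0 b, γ t = δ t ∧ ∀ u ∈ Set.Icc 0 b, γ u = δ u → u ≤ t := by
  set A : Set ℝ := {t | t ∈ Set.Icc 0 b ∧ γ t = δ t} with hA
  have hne : A.Nonempty := ⟨0, ⟨le_rfl, hb⟩, h0⟩
  have hbd : BddAbove A := ⟨b, fun t ht => ht.1.2⟩
  have hmem : sSup A ∈ Set.Icc 0 b :=
    ⟨le_csSup hbd ⟨⟨le_rfl, hb⟩, h0⟩, csSup_le hne fun t ht => ht.1.2⟩
  refine ⟨sSup A, hmem, ?_, fun u hu he => le_csSup hbd ⟨hu, he⟩⟩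
  refine dist_le_zero.1 (le_of_forall_pos_le_add fun ε hε => ?_)
  obtain ⟨t, ht, hlt⟩ := exists_lt_of_lt_csSup hne (show sSup A - ε / 2 < sSup A by linarith)
  have hle := le_csSup hbd ht
  have e1 := hγ _ hmem t ht.1
  have e2 := hδ t ht.1 _ hmem
  rw [abs_of_nonneg (by linarith)] at e1
  rw [abs_of_nonpos (by linarith)] at e2
  have := dist_triangle (γ (sSup A)) (γ t) (δ (sSup A))
  rw [ht.2] at this e1
  linarith

/-- Every triple of points of an ℝ-tree has a median. -/
theorem IsRTree.exists_median (h : IsRTree X) (x y z : X) :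
    ∃ m, dist x m + dist m y = dist x y ∧ dist y m + dist m z = dist y z ∧
      dist x m + dist m z = dist x z := by
  obtain ⟨γ, hγ0, hγ1, hγ⟩ := h.exists_param y x
  obtain ⟨δ, hδ0, hδ1, hδ⟩ := h.exists_param y z
  have hbx : min (dist y x) (dist y z) ≤ dist y x := min_le_left _ _
  have hbz : min (dist y x) (dist y z) ≤ dist y z := min_le_right _ _
  have hb0 : 0 ≤ min (dist y x) (dist y z) := le_min dist_nonneg dist_nonneg
  obtain ⟨t, ht, hteq, htmax⟩ := exists_last_agreement hb0
    (fun u hu v hv => hγ u ⟨hu.1, hu.2.trans hbx⟩ v ⟨hv.1, hv.2.trans hbx⟩)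
    (fun u hu v hv => hδ u ⟨hu.1, hu.2.trans hbz⟩ v ⟨hv.1, hv.2.trans hbz⟩) (hγ0.trans hδ0.symm)
  have dγ : ∀ u ∈ Set.Icc 0 (dist y x), dist y (γ u) = u ∧ dist (γ u) x = dist y x - u := by
    intro u hu
    have e1 := hγ 0 ⟨le_rfl, dist_nonneg⟩ u hu
    have e2 := hγ u hu _ ⟨dist_nonneg, le_rfl⟩
    rw [abs_of_nonpos (by linarith [hu.1]), hγ0] at e1
    rw [abs_of_nonpos (by linarith [hu.2]), hγ1] at e2
    constructor <;> linarith
  have dδ : ∀ u ∈ Set.Icc 0 (dist y z), dist y (δ u) = u ∧ dist (δ u) z = dist y z - u := by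
    intro u hu
    have e1 := hδ 0 ⟨le_rfl, dist_nonneg⟩ u hu
    have e2 := hδ u hu _ ⟨dist_nonneg, le_rfl⟩
    rw [abs_of_nonpos (by linarith [hu.1]), hδ0] at e1
    rw [abs_of_nonpos (by linarith [hu.2]), hδ1] at e2
    constructor <;> linarith
  have m1 := dγ t ⟨ht.1, ht.2.trans hbx⟩
  have m2 := dδ t ⟨ht.1, ht.2.trans hbz⟩
  rw [← hteq] at m2
  refine ⟨γ t, ?_, ?_, ?_⟩
  · rw [dist_comm x, dist_comm _ y, dist_comm x]; linarith
  · linarith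
  · obtain ⟨s, hs, -⟩ := h.1 x (γ t)
    obtain ⟨s', hs', -⟩ := h.1 (γ t) z
    refine (h.2 s s' _ _ _ hs hs' ?_).dist_add (Or.inl hs.right_mem)
    ext w
    constructor
    · rintro ⟨h1, h2⟩
      have e1 := hs.dist_add h1
      have e2 := hs'.dist_add h2
      have c1 := dist_comm x w
      have c2 := dist_comm w (γ t)
      have c3 := dist_comm x (γ t)
      have t1 := dist_triangle y w x
      have t2 := dist_triangle y (γ t) w
      have t3 := dist_triangle y w z
      have hr : 0 ≤ dist (γ t) w := dist_nonneg
      have p1 : 0 ≤ dist x w := dist_nonneg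
      have p2 : 0 ≤ dist w z := dist_nonneg
      have hrx : t + dist (γ t) w ≤ dist y x := by linarith [m1.2]
      have hrz : t + dist (γ t) w ≤ dist y z := by linarith [m2.2]
      have f1 := dγ _ ⟨by linarith [ht.1], hrx⟩
      have f2 := dδ _ ⟨by linarith [ht.1], hrz⟩
      have g1 : w = γ (t + dist (γ t) w) :=
        h.eq_of_between (x := y) (y := x) (by linarith) (by linarith) (by linarith)
      have g2 : w = δ (t + dist (γ t) w) :=
        h.eq_of_between (x := y) (y := z) (by linarith) (by linarith) (by linarith)
      have := htmax (t + dist (γ t) w) ⟨by linarith [ht.1], le_min hrx hrz⟩ (g1.symm.trans g2)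
      exact (dist_le_zero.1 (by linarith)).symm
    · rintro rfl
      exact ⟨hs.right_mem, hs'.left_mem⟩

/-- Two overlapping aligned triples give an aligned quadruple. -/
theorem IsRTree.dist_eq_of_overlap (h : IsRTree X) {p x y q : X} (hxy : x ≠ y)
    (h1 : dist p y = dist p x + dist x y) (h2 : dist x q = dist x y + dist y q) :
    dist p q = dist p x + dist x y + dist y q := by
  obtain ⟨m, m1, m2, m3⟩ := h.exists_median p y q
  have c1 := dist_comm m y
  have hpos : 0 < dist x y := dist_pos.2 hxy
  suffices hm : dist y m ≤ 0 by
    have : y = m := dist_le_zero.1 hm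
    subst this
    linarith
  by_contra! hm
  have c2 := dist_comm p m
  have c3 := dist_comm p x
  have c4 := dist_comm p y
  have c5 := dist_comm x y
  rcases le_total (dist y m) (dist y x) with hle | hle
  · obtain ⟨γ, hγ0, hγ1, hγ⟩ := h.exists_param y x
    have e1 := hγ 0 ⟨le_rfl, dist_nonneg⟩ (dist y m) ⟨dist_nonneg, hle⟩
    have e2 := hγ (dist y m) ⟨dist_nonneg, hle⟩ _ ⟨dist_nonneg, le_rfl⟩
    rw [abs_of_nonpos (by linarith), hγ0] at e1
    rw [abs_of_nonpos (by linarith), hγ1] at e2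
    have t1 := dist_triangle (γ (dist y m)) x p
    have t2 := dist_triangle y (γ (dist y m)) p
    have : m = γ (dist y m) :=
      h.eq_of_between (x := y) (y := p) (by linarith) (by linarith) (by linarith)
    rw [← this] at e2
    have t3 := dist_triangle x m q
    have := dist_comm m x
    linarith
  · obtain ⟨γ, hγ0, hγ1, hγ⟩ := h.exists_param y m
    have e1 := hγ 0 ⟨le_rfl, dist_nonneg⟩ (dist y x) ⟨dist_nonneg, hle⟩
    have e2 := hγ (dist y x) ⟨dist_nonneg, hle⟩ _ ⟨dist_nonneg, le_rfl⟩
    rw [abs_of_nonpos (by linarith), hγ0] at e1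
    rw [abs_of_nonpos (by linarith), hγ1] at e2
    have t1 := dist_triangle (γ (dist y x)) m p
    have t2 := dist_triangle y (γ (dist y x)) p
    have : x = γ (dist y x) :=
      h.eq_of_between (x := y) (y := p) (by linarith) (by linarith) (by linarith)
    rw [← this] at e2
    have t3 := dist_triangle x m q
    linarith

end RTree

section Rays

/-- Two parametrized rays eventually coincide, up to a shift of the parameter. -/
def Asymptotic {X : Type*} (γ δ : ℝ → X) : Prop :=
  ∃ a b : ℝ, 0 ≤ a ∧ 0 ≤ b ∧ ∀ s, 0 ≤ s → γ (a + s) = δ (b + s)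

theorem Asymptotic.refl {X : Type*} (γ : ℝ → X) : Asymptotic γ γ := ⟨0, 0, le_rfl, le_rfl, fun _ _ => rfl⟩

theorem Asymptotic.symm {X : Type*} {γ δ : ℝ → X} (h : Asymptotic γ δ) : Asymptotic δ γ := by
  obtain ⟨a, b, ha, hb, h⟩ := h
  exact ⟨b, a, hb, ha, fun s hs => (h s hs).symm⟩

theorem Asymptotic.trans {X : Type*} {γ δ ε : ℝ → X} (h : Asymptotic γ δ) (h' : Asymptotic δ ε) :
    Asymptotic γ ε := by
  obtain ⟨a, b, ha, hb, h⟩ := h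
  obtain ⟨c, d, hc, hd, h'⟩ := h'
  refine ⟨a + c, d + b, by linarith, by linarith, fun s hs => ?_⟩
  rw [add_assoc, h _ (by linarith), add_assoc, ← h' _ (by linarith)]
  congr 1; ring

variable {X : Type*} [MetricSpace X]

/-- `γ` restricts to an isometric embedding of `[0, ∞)`. -/
def IsRayMap (γ : ℝ → X) : Prop :=
  ∀ u ∈ Set.Ici (0 : ℝ), ∀ v ∈ Set.Ici (0 : ℝ), dist (γ u) (γ v) = |u - v|

/-- The end of `X` represented by a parametrized ray. -/
def rayEnd (γ : ℝ → X) : Set (Set X) :=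
  {R : Set X | IsRay R ∧ IsRay (R ∩ γ '' Set.Ici 0)}

theorem IsRayMap.dist_eq {γ : ℝ → X} (hγ : IsRayMap γ) {u v : ℝ} (hu : 0 ≤ u) (huv : u ≤ v) :
    dist (γ u) (γ v) = v - u := by
  rw [hγ u hu v (hu.trans huv), abs_of_nonpos (by linarith)]; ring

theorem IsRayMap.dist_zero {γ : ℝ → X} (hγ : IsRayMap γ) {u : ℝ} (hu : 0 ≤ u) :
    dist (γ 0) (γ u) = u := by
  rw [hγ.dist_eq le_rfl hu]; ring

theorem IsRayMap.shift {γ : ℝ → X} (hγ : IsRayMap γ) {t : ℝ} (ht : 0 ≤ t) :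
    IsRayMap fun s => γ (t + s) := by
  intro u hu v hv
  rw [Set.mem_Ici] at hu hv
  rw [hγ _ (add_nonneg ht hu) _ (add_nonneg ht hv)]
  congr 1; ring

theorem IsRayMap.comp_isometry {γ : ℝ → X} (hγ : IsRayMap γ) {g : X → X} (hg : Isometry g) :
    IsRayMap fun s => g (γ s) := by
  intro u hu v hv
  rw [hg.dist_eq]
  exact hγ u hu v hv

theorem IsRayMap.isRay {γ : ℝ → X} (hγ : IsRayMap γ) : IsRay (γ '' Set.Ici 0) := ⟨γ, hγ, rfl⟩

theorem IsRTree.eq_ray (h : IsRTree X) {γ : ℝ → X} (hγ : IsRayMap γ) {p : X} {b : ℝ} (hb : 0 ≤ b)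
    (hp : dist (γ 0) p + dist p (γ b) = b) : p = γ (dist (γ 0) p) := by
  have h0 : 0 ≤ dist (γ 0) p := dist_nonneg
  have h1 : dist (γ 0) p ≤ b := by linarith [@dist_nonneg _ _ p (γ b)]
  have e0 := hγ.dist_zero hb
  have e1 := hγ.dist_zero h0
  have e2 := hγ.dist_eq h0 h1
  exact h.eq_of_between (x := γ 0) (y := γ b) (by linarith) (by linarith) e1.symm

theorem IsRTree.ray_agree (h : IsRTree X) {γ δ : ℝ → X} (hγ : IsRayMap γ) (hδ : IsRayMap δ)
    (h0 : γ 0 = δ 0) {b t : ℝ} (hb : γ b = δ b) (ht : 0 ≤ t) (htb : t ≤ b) : γ t = δ t := by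
  have e1 := hδ.dist_zero ht
  have e2 := hδ.dist_eq ht htb
  have := h.eq_ray hγ (ht.trans htb) (p := δ t) (by rw [h0, hb]; linarith)
  rw [this, h0, e1]

theorem IsRTree.eq_of_asymptotic (h : IsRTree X) {γ δ : ℝ → X} (hγ : IsRayMap γ)
    (hδ : IsRayMap δ) (h0 : γ 0 = δ 0) (has : Asymptotic γ δ) {t : ℝ} (ht : 0 ≤ t) :
    γ t = δ t := by
  obtain ⟨a, b, ha, hb, has⟩ := has
  have h1 := has t ht
  have e1 := hγ.dist_zero (add_nonneg ha ht)
  have e2 := hδ.dist_zero (add_nonneg hb ht)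
  rw [h1, h0, e2] at e1
  rw [e1] at h1
  exact h.ray_agree hγ hδ h0 h1 ht (by linarith)

/-- An isometric embedding of `[0, ∞)` into itself is a translation. -/
theorem eq_add_of_isometric {f : ℝ → ℝ} (hf0 : ∀ u, 0 ≤ u → 0 ≤ f u)
    (hf : ∀ u, 0 ≤ u → ∀ v, 0 ≤ v → |f u - f v| = |u - v|) {u : ℝ} (hu : 0 ≤ u) :
    f u = f 0 + u := by
  have p0 := hf0 0 le_rfl
  have pv := hf0 (f 0 + u + 1) (by linarith)
  have pu := hf0 u hu
  have e1 := hf 0 le_rfl (f 0 + u + 1) (by linarith)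
  have e2 := hf u hu (f 0 + u + 1) (by linarith)
  have e3 := (le_abs_self _).trans_eq (hf u hu 0 le_rfl)
  rw [sub_zero, abs_of_nonneg hu] at e3
  rw [abs_of_nonpos (show 0 - (f 0 + u + 1) ≤ 0 by linarith)] at e1
  rw [abs_of_nonpos (show u - (f 0 + u + 1) ≤ 0 by linarith)] at e2
  rcases abs_cases (f 0 - f (f 0 + u + 1)) with ⟨h1, h2⟩ | ⟨h1, h2⟩ <;>
  rcases abs_cases (f u - f (f 0 + u + 1)) with ⟨h3, h4⟩ | ⟨h3, h4⟩ <;>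
  linarith

theorem IsRayMap.exists_shift_of_subset {γ ρ : ℝ → X} (hγ : IsRayMap γ) (hρ : IsRayMap ρ)
    (hsub : ρ '' Set.Ici 0 ⊆ γ '' Set.Ici 0) :
    ∃ a, 0 ≤ a ∧ ∀ s, 0 ≤ s → ρ s = γ (a + s) := by
  have : ∀ u : ℝ, ∃ t, 0 ≤ u → 0 ≤ t ∧ γ t = ρ u := by
    intro u
    by_cases hu : 0 ≤ u
    · obtain ⟨t, ht, he⟩ := hsub ⟨u, hu, rfl⟩
      exact ⟨t, fun _ => ⟨ht, he⟩⟩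
    · exact ⟨0, fun h => absurd h hu⟩
  choose f hf using this
  refine ⟨f 0, (hf 0 le_rfl).1, fun s hs => ?_⟩
  rw [← eq_add_of_isometric (fun u hu => (hf u hu).1) (fun u hu v hv => ?_) hs, (hf s hs).2]
  rw [← hγ _ (hf u hu).1 _ (hf v hv).1, (hf u hu).2, (hf v hv).2, hρ u hu v hv]

theorem IsRTree.isRay_inter_iff (h : IsRTree X) {γ δ : ℝ → X} (hγ : IsRayMap γ)
    (hδ : IsRayMap δ) :
    IsRay (γ '' Set.Ici 0 ∩ δ '' Set.Ici 0) ↔ Asymptotic γ δ := by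
  constructor
  · rintro ⟨ρ, hρ, he⟩
    obtain ⟨a, ha, h1⟩ := hγ.exists_shift_of_subset hρ (he ▸ Set.inter_subset_left)
    obtain ⟨b, hb, h2⟩ := hδ.exists_shift_of_subset hρ (he ▸ Set.inter_subset_right)
    exact ⟨a, b, ha, hb, fun s hs => (h1 s hs).symm.trans (h2 s hs)⟩
  · rintro ⟨a, b, ha, hb, hab⟩
    set A : Set ℝ := {t | 0 ≤ t ∧ γ t ∈ δ '' Set.Ici 0} with hA
    have hshift : ∀ t ∈ A, 0 ≤ t + (b - a) ∧ γ t = δ (t + (b - a)) := by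
      rintro t ⟨ht, u, hu, he⟩
      rw [Set.mem_Ici] at hu
      have key : u = t + (b - a) := by
        have e1 := hγ t ht (a + (t + u)) (by simp only [Set.mem_Ici]; linarith)
        have e2 := hδ u hu (b + (t + u)) (by simp only [Set.mem_Ici]; linarith)
        rw [abs_of_nonpos (by linarith), ← he, hab _ (by linarith), e2,
          abs_of_nonpos (by linarith)] at e1
        linarith
      rw [← key]
      exact ⟨hu, he.symm⟩
    have haA : a ∈ A := ⟨ha, b, hb, by simpa using (hab 0 le_rfl).symm⟩
    have hbd : BddBelow A := ⟨0, fun t ht => ht.1⟩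
    have hinf0 : 0 ≤ sInf A := le_csInf ⟨a, haA⟩ fun t ht => ht.1
    have hinfb : 0 ≤ sInf A + (b - a) := by
      have : a - b ≤ sInf A := le_csInf ⟨a, haA⟩ fun t ht => by linarith [(hshift t ht).1]
      linarith
    have hinf : γ (sInf A) = δ (sInf A + (b - a)) := by
      refine dist_le_zero.1 (le_of_forall_pos_le_add fun ε hε => ?_)
      obtain ⟨t, ht, hlt⟩ := exists_lt_of_csInf_lt ⟨a, haA⟩
        (show sInf A < sInf A + ε / 2 by linarith)
      have hle := csInf_le hbd ht
      have e1 := hγ.dist_eq hinf0 hle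
      have e2 := hδ.dist_eq hinfb (show sInf A + (b - a) ≤ t + (b - a) by linarith)
      rw [← (hshift t ht).2, dist_comm] at e2
      have := dist_triangle (γ (sInf A)) (γ t) (δ (sInf A + (b - a)))
      linarith
    have hgo : ∀ s, 0 ≤ s → γ (sInf A + s) = δ (sInf A + (b - a) + s) := by
      intro s hs
      refine h.ray_agree (b := a + s) (hγ.shift hinf0) (hδ.shift hinfb) (by simpa using hinf)
        ?_ hs (by linarith)
      have := hab (sInf A + s) (by linarith)
      rw [show sInf A + (a + s) = a + (sInf A + s) by ring, this]
      congr 1; ring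
    refine ⟨fun s => γ (sInf A + s), hγ.shift hinf0, ?_⟩
    ext p
    constructor
    · rintro ⟨⟨t, ht, rfl⟩, h2⟩
      have := csInf_le hbd (show t ∈ A from ⟨ht, h2⟩)
      exact ⟨t - sInf A, by simp only [Set.mem_Ici]; linarith, by simp⟩
    · rintro ⟨s, hs, rfl⟩
      rw [Set.mem_Ici] at hs
      exact ⟨⟨_, add_nonneg hinf0 hs, rfl⟩, ⟨_, add_nonneg hinfb hs, (hgo s hs).symm⟩⟩

theorem IsRTree.mem_rayEnd_iff (h : IsRTree X) {γ δ : ℝ → X} (hγ : IsRayMap γ)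
    (hδ : IsRayMap δ) : γ '' Set.Ici 0 ∈ rayEnd δ ↔ Asymptotic γ δ := by
  rw [← h.isRay_inter_iff hγ hδ]
  exact ⟨fun hm => hm.2, fun hi => ⟨hγ.isRay, hi⟩⟩

theorem IsRTree.rayEnd_eq_iff (h : IsRTree X) {γ δ : ℝ → X} (hγ : IsRayMap γ)
    (hδ : IsRayMap δ) : rayEnd γ = rayEnd δ ↔ Asymptotic γ δ := by
  constructor
  · intro he
    rw [← h.mem_rayEnd_iff hγ hδ, ← he, h.mem_rayEnd_iff hγ hγ]
    exact Asymptotic.refl γ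
  · intro has
    ext R
    constructor <;> rintro ⟨⟨ρ, hρ, rfl⟩, hi⟩
    · exact (h.mem_rayEnd_iff hρ hδ).2 (((h.isRay_inter_iff hρ hγ).1 hi).trans has)
    · exact (h.mem_rayEnd_iff hρ hγ).2 (((h.isRay_inter_iff hρ hδ).1 hi).trans has.symm)

theorem isEnd_iff {e : Set (Set X)} : IsEnd e ↔ ∃ γ, IsRayMap γ ∧ e = rayEnd γ := by
  constructor
  · rintro ⟨R, ⟨γ, hγ, rfl⟩, rfl⟩
    exact ⟨γ, hγ, rfl⟩
  · rintro ⟨γ, hγ, rfl⟩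
    exact ⟨_, hγ.isRay, rfl⟩

theorem IsRayMap.isEnd {γ : ℝ → X} (hγ : IsRayMap γ) : IsEnd (rayEnd γ) :=
  isEnd_iff.2 ⟨γ, hγ, rfl⟩

theorem IsRTree.exists_prepend (h : IsRTree X) {γ : ℝ → X} (hγ : IsRayMap γ) {x : X}
    (hx : ∀ s, 0 ≤ s → dist x (γ s) = dist x (γ 0) + s) :
    ∃ δ, IsRayMap δ ∧ δ 0 = x ∧ ∀ s, 0 ≤ s → δ (dist x (γ 0) + s) = γ s := by
  obtain ⟨α, hα0, hα1, hα⟩ := h.exists_param x (γ 0)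
  set d := dist x (γ 0) with hd
  have hd0 : 0 ≤ d := dist_nonneg
  have key : ∀ u, 0 ≤ u → u ≤ d → ∀ s, 0 ≤ s → dist (α u) (γ s) = d - u + s := by
    intro u hu hud s hs
    have e1 := hα 0 ⟨le_rfl, hd0⟩ u ⟨hu, hud⟩
    have e2 := hα u ⟨hu, hud⟩ d ⟨hd0, le_rfl⟩
    rw [abs_of_nonpos (by linarith), hα0] at e1
    rw [abs_of_nonpos (by linarith), hα1] at e2
    have := hγ.dist_zero hs
    have := dist_triangle (α u) (γ 0) (γ s)
    have := dist_triangle x (α u) (γ s)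
    have := hx s hs
    linarith
  refine ⟨fun u => if u ≤ d then α u else γ (u - d), ?_, ?_, ?_⟩
  · intro u hu v hv
    rw [Set.mem_Ici] at hu hv
    by_cases h1 : u ≤ d <;> by_cases h2 : v ≤ d <;> simp only [h1, h2, if_true, if_false]
    · exact hα u ⟨hu, h1⟩ v ⟨hv, h2⟩
    · rw [key u hu h1 _ (by linarith), abs_of_nonpos (by linarith)]; ring
    · rw [dist_comm, key v hv h2 _ (by linarith), abs_of_nonneg (by linarith)]; ring
    · push Not at h1 h2
      rw [hγ _ (by simp only [Set.mem_Ici]; linarith) _ (by simp only [Set.mem_Ici]; linarith)]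
      congr 1; ring
  · simp [hd0, hα0]
  · intro s hs
    rcases hs.eq_or_lt with rfl | hs
    · simp [hα1]
    · simp [hs]

theorem IsRTree.exists_asymptotic_from (h : IsRTree X) {γ : ℝ → X} (hγ : IsRayMap γ) (x : X) :
    ∃ δ, IsRayMap δ ∧ δ 0 = x ∧ Asymptotic δ γ := by
  have hd : 0 ≤ dist x (γ 0) := dist_nonneg
  obtain ⟨δ, hδ, h0, h1⟩ := h.exists_prepend (x := x) (hγ.shift hd) (by
    intro s hs
    obtain ⟨m, m1, m2, m3⟩ := h.exists_median x (γ 0) (γ (dist x (γ 0) + s))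
    have e0 := hγ.dist_zero (add_nonneg hd hs)
    have hm := h.eq_ray hγ (add_nonneg hd hs) (p := m) (by linarith)
    have c := dist_comm m (γ 0)
    have hle : dist (γ 0) m ≤ dist x (γ 0) := by linarith [@dist_nonneg _ _ x m]
    have e1 := hγ.dist_eq dist_nonneg hle
    rw [← hm] at e1
    have e2 := hγ.dist_eq hd (show dist x (γ 0) ≤ dist x (γ 0) + s by linarith)
    have t1 := dist_triangle x m (γ (dist x (γ 0)))
    have t2 := dist_triangle x (γ (dist x (γ 0))) (γ (dist x (γ 0) + s))
    simp only [add_zero]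
    linarith)
  exact ⟨δ, hδ, h0, _, _, dist_nonneg, hd, h1⟩

/-- Two rays from the same point leaving it in different directions form a line. -/
theorem IsRTree.dist_opposite (h : IsRTree X) {γ δ : ℝ → X} (hγ : IsRayMap γ) (hδ : IsRayMap δ)
    (h0 : γ 0 = δ 0) (hne : ∀ u, 0 < u → γ u ≠ δ u) {s t : ℝ} (hs : 0 ≤ s) (ht : 0 ≤ t) :
    dist (γ s) (δ t) = s + t := by
  obtain ⟨m, m1, m2, m3⟩ := h.exists_median (γ s) (γ 0) (δ t)
  have e1 := hγ.dist_zero hs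
  have e2 := hδ.dist_zero ht
  have c1 := dist_comm (γ s) m
  have c2 := dist_comm (γ 0) m
  have c3 := dist_comm (γ s) (γ 0)
  rw [← h0] at e2
  have g1 := h.eq_ray hγ hs (p := m) (by linarith)
  have g2 := h.eq_ray hδ ht (p := m) (by rw [← h0]; linarith)
  rw [← h0] at g2
  rcases (@dist_nonneg _ _ (γ 0) m).eq_or_lt with hz | hz
  · linarith
  · exact absurd (g1.symm.trans g2) (hne _ hz)

theorem locCoincide_iff {γ δ : ℝ → X} (hγ : IsRayMap γ) (hδ : IsRayMap δ) (h0 : γ 0 = δ 0) :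
    LocCoincide (γ 0) (γ '' Set.Ici 0) (δ '' Set.Ici 0) ↔ ∃ u, 0 < u ∧ γ u = δ u := by
  constructor
  · rintro ⟨p, ⟨⟨u, hu, rfl⟩, v, hv, he⟩, hne⟩
    have e1 := hγ.dist_zero hu
    have e2 := hδ.dist_zero hv
    rw [he, ← h0, e1] at e2
    subst e2
    refine ⟨u, lt_of_le_of_ne hu ?_, he.symm⟩
    rintro rfl
    exact hne rfl
  · rintro ⟨u, hu, he⟩
    refine ⟨γ u, ⟨⟨u, hu.le, rfl⟩, u, hu.le, he.symm⟩, fun hc => ?_⟩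
    have e1 := hγ.dist_zero hu.le
    rw [hc, dist_self] at e1
    linarith

theorem isBranchPoint_iff {x : X} : IsBranchPoint x ↔ ∃ γ₁ γ₂ γ₃ : ℝ → X,
    (IsRayMap γ₁ ∧ γ₁ 0 = x) ∧ (IsRayMap γ₂ ∧ γ₂ 0 = x) ∧ (IsRayMap γ₃ ∧ γ₃ 0 = x) ∧
    (∀ u, 0 < u → γ₁ u ≠ γ₂ u) ∧ (∀ u, 0 < u → γ₁ u ≠ γ₃ u) ∧
    (∀ u, 0 < u → γ₂ u ≠ γ₃ u) := by
  have key : ∀ {γ δ : ℝ → X}, IsRayMap γ → IsRayMap δ → γ 0 = x → δ 0 = x →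
      (¬ LocCoincide x (γ '' Set.Ici 0) (δ '' Set.Ici 0) ↔ ∀ u, 0 < u → γ u ≠ δ u) := by
    intro γ δ hγ hδ h1 h2
    rw [← h1, locCoincide_iff hγ hδ (h1.trans h2.symm)]
    push Not
    rfl
  constructor
  · rintro ⟨_, _, _, ⟨γ₁, h1, z1, rfl⟩, ⟨γ₂, h2, z2, rfl⟩, ⟨γ₃, h3, z3, rfl⟩, h12, h13, h23⟩
    exact ⟨γ₁, γ₂, γ₃, ⟨h1, z1⟩, ⟨h2, z2⟩, ⟨h3, z3⟩, (key h1 h2 z1 z2).1 h12,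
      (key h1 h3 z1 z3).1 h13, (key h2 h3 z2 z3).1 h23⟩
  · rintro ⟨γ₁, γ₂, γ₃, ⟨h1, z1⟩, ⟨h2, z2⟩, ⟨h3, z3⟩, h12, h13, h23⟩
    exact ⟨_, _, _, ⟨γ₁, h1, z1, rfl⟩, ⟨γ₂, h2, z2, rfl⟩, ⟨γ₃, h3, z3, rfl⟩,
      (key h1 h2 z1 z2).2 h12, (key h1 h3 z1 z3).2 h13, (key h2 h3 z2 z3).2 h23⟩

theorem IsBranchPoint.map_isometry {x : X} (hx : IsBranchPoint x) {g : X → X} (hg : Isometry g) :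
    IsBranchPoint (g x) := by
  obtain ⟨γ₁, γ₂, γ₃, ⟨h1, z1⟩, ⟨h2, z2⟩, ⟨h3, z3⟩, h12, h13, h23⟩ := isBranchPoint_iff.1 hx
  exact isBranchPoint_iff.2 ⟨_, _, _, ⟨h1.comp_isometry hg, congrArg g z1⟩,
    ⟨h2.comp_isometry hg, congrArg g z2⟩, ⟨h3.comp_isometry hg, congrArg g z3⟩,
    fun u hu => hg.injective.ne (h12 u hu), fun u hu => hg.injective.ne (h13 u hu),
    fun u hu => hg.injective.ne (h23 u hu)⟩

/-- The point where two distinct rays leaving `x` in the same direction separate is a branch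
point, provided some ray leaves `x` in another direction. -/
theorem IsRTree.exists_branchPoint_of_diverge (h : IsRTree X) {γ δ ρ : ℝ → X}
    (hγ : IsRayMap γ) (hδ : IsRayMap δ) (hρ : IsRayMap ρ) (hδ0 : γ 0 = δ 0) (hρ0 : γ 0 = ρ 0)
    {u c : ℝ} (hu : 0 < u) (hue : γ u = δ u) (hc : 0 ≤ c) (hce : γ c ≠ δ c)
    (hne : ∀ u, 0 < u → γ u ≠ ρ u) : ∃ t, 0 < t ∧ IsBranchPoint (γ t) := by
  obtain ⟨t, ht, hte, htmax⟩ := exists_last_agreement hc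
    (fun u hu v hv => hγ u hu.1 v hv.1) (fun u hu v hv => hδ u hu.1 v hv.1) hδ0
  have huc : u ≤ c := by
    by_contra! hlt
    exact hce (h.ray_agree hγ hδ hδ0 hue hc hlt.le)
  have ht0 : 0 < t := hu.trans_le (htmax u ⟨hu.le, huc⟩ hue)
  have hneδ : ∀ v, 0 < v → δ v ≠ ρ v := by
    intro v hv he
    have hm : 0 < min u v := lt_min hu hv
    apply hne _ hm
    rw [h.ray_agree hγ hδ hδ0 hue hm.le (min_le_left _ _),
      h.ray_agree hδ hρ (hδ0.symm.trans hρ0) he hm.le (min_le_right _ _)]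
  have hd0 : dist (γ t) (ρ 0) = t := by rw [← hρ0, dist_comm, hγ.dist_zero ht.1]
  obtain ⟨κ, hκ, hκ0, hκ1⟩ := h.exists_prepend hρ (x := γ t) (fun s hs => by
    rw [h.dist_opposite hγ hρ hρ0 hne ht.1 hs, hd0])
  have hκt : κ t = γ 0 := by
    have := hκ1 0 le_rfl
    rw [hd0, add_zero] at this
    rw [this, hρ0]
  have hback : ∀ {ε : ℝ → X}, IsRayMap ε → ε 0 = γ 0 → ε t = γ t →
      ∀ v, 0 < v → ε (t + v) ≠ κ v := by
    intro ε hε h1 h2 v hv he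
    have hm : 0 < min v t := lt_min hv ht0
    have hag : ε (t + min v t) = κ (min v t) :=
      h.ray_agree (hε.shift ht.1) hκ (by simp [h2, hκ0]) he hm.le (min_le_left _ _)
    have e1 := hκ.dist_eq hm.le (min_le_right v t)
    have e2 := hε.dist_zero (add_nonneg ht.1 hm.le)
    rw [← hag, hκt, ← h1, dist_comm, e2] at e1
    linarith
  refine ⟨t, ht0, isBranchPoint_iff.2 ⟨fun s => γ (t + s), fun s => δ (t + s), κ,
    ⟨hγ.shift ht.1, by simp⟩, ⟨hδ.shift ht.1, by simp [hte]⟩, ⟨hκ, hκ0⟩, ?_,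
    hback hγ rfl rfl, hback hδ hδ0.symm hte.symm⟩⟩
  intro v hv he
  have hle : t + min v (c - t) ≤ c := by linarith [min_le_right v (c - t)]
  have hlt : t < c := lt_of_le_of_ne ht.2 (by rintro rfl; exact hce hte)
  have hm : 0 < min v (c - t) := lt_min hv (by linarith)
  have := htmax (t + min v (c - t)) ⟨by linarith, hle⟩
    (h.ray_agree hγ hδ hδ0 he (by linarith) (by linarith [min_le_left v (c - t)]))
  linarith

end Rays

section Ends

variable {X : Type*} [MetricSpace X]

theorem IsRTree.away_or_away (h : IsRTree X) {γ δ : ℝ → X} (hγ : IsRayMap γ) (hδ : IsRayMap δ)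
    (h0 : γ 0 = δ 0) (hne : ∀ u, 0 < u → γ u ≠ δ u) (y : X) :
    (∀ s, 0 ≤ s → dist y (γ s) = dist y (γ 0) + s) ∨
      (∀ s, 0 ≤ s → dist y (δ s) = dist y (δ 0) + s) := by
  have key : ∀ {γ : ℝ → X}, IsRayMap γ → (¬ ∀ s, 0 ≤ s → dist y (γ s) = dist y (γ 0) + s) →
      ∃ u, 0 < u ∧ dist y (γ u) + u = dist y (γ 0) := by
    intro γ hγ hn
    push Not at hn
    obtain ⟨s, hs, hns⟩ := hn
    obtain ⟨m, m1, m2, m3⟩ := h.exists_median y (γ 0) (γ s)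
    have e0 := hγ.dist_zero hs
    have c := dist_comm m (γ 0)
    have hm := h.eq_ray hγ hs (p := m) (by linarith)
    refine ⟨dist (γ 0) m, lt_of_le_of_ne dist_nonneg fun hz => hns ?_, by rw [← hm]; linarith⟩
    linarith
  by_contra! hcon
  obtain ⟨⟨s, hs, hs'⟩, r, hr, hr'⟩ := hcon
  obtain ⟨u, hu, hue⟩ := key hγ fun hf => hs' (hf s hs)
  obtain ⟨v, hv, hve⟩ := key hδ fun hf => hr' (hf r hr)
  have hm : 0 < min u v := lt_min hu hv
  apply hne _ hm
  have e1 := hγ.dist_zero hm.le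
  have e2 := hγ.dist_eq hm.le (min_le_left u v)
  have e3 := hδ.dist_zero hm.le
  have e4 := hδ.dist_eq hm.le (min_le_right u v)
  have t1 := dist_triangle (γ (min u v)) (γ u) y
  have t2 := dist_triangle (δ (min u v)) (δ v) y
  have t3 := dist_triangle (γ 0) (γ (min u v)) y
  have t4 := dist_triangle (δ 0) (δ (min u v)) y
  rw [dist_comm y, dist_comm y] at hue hve
  rw [← h0] at *
  exact h.eq_of_between (x := γ 0) (y := y) (by linarith) (by linarith) (by linarith)

theorem Asymptotic.eq_of_away {γ δ : ℝ → X} (hγ : IsRayMap γ) (hδ : IsRayMap δ)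
    (has : Asymptotic γ δ) (h1 : ∀ s, 0 ≤ s → dist (δ 0) (γ s) = dist (δ 0) (γ 0) + s)
    (h2 : ∀ s, 0 ≤ s → dist (γ 0) (δ s) = dist (γ 0) (δ 0) + s) : γ 0 = δ 0 := by
  obtain ⟨a, b, ha, hb, has⟩ := has
  have e := has 0 le_rfl
  rw [add_zero, add_zero] at e
  have e1 := h1 a ha
  have e2 := h2 b hb
  rw [e, hδ.dist_zero hb] at e1
  rw [← e, hγ.dist_zero ha] at e2
  have := dist_comm (γ 0) (δ 0)
  exact dist_le_zero.1 (by linarith)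

/-- A branch point is determined by the ends of three rays leaving it in different directions. -/
theorem IsRTree.tripod_center_eq (h : IsRTree X) {x y : X} {γ₁ γ₂ γ₃ δ₁ δ₂ δ₃ : ℝ → X}
    (hγ₁ : IsRayMap γ₁) (hγ₂ : IsRayMap γ₂) (hγ₃ : IsRayMap γ₃)
    (hδ₁ : IsRayMap δ₁) (hδ₂ : IsRayMap δ₂) (hδ₃ : IsRayMap δ₃)
    (x₁ : γ₁ 0 = x) (x₂ : γ₂ 0 = x) (x₃ : γ₃ 0 = x)
    (y₁ : δ₁ 0 = y) (y₂ : δ₂ 0 = y) (y₃ : δ₃ 0 = y)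
    (γ₁₂ : ∀ u, 0 < u → γ₁ u ≠ γ₂ u) (γ₁₃ : ∀ u, 0 < u → γ₁ u ≠ γ₃ u)
    (γ₂₃ : ∀ u, 0 < u → γ₂ u ≠ γ₃ u)
    (δ₁₂ : ∀ u, 0 < u → δ₁ u ≠ δ₂ u) (δ₁₃ : ∀ u, 0 < u → δ₁ u ≠ δ₃ u)
    (δ₂₃ : ∀ u, 0 < u → δ₂ u ≠ δ₃ u)
    (as₁ : Asymptotic γ₁ δ₁) (as₂ : Asymptotic γ₂ δ₂) (as₃ : Asymptotic γ₃ δ₃) : x = y := by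
  have a₁₂ := h.away_or_away hγ₁ hγ₂ (x₁.trans x₂.symm) γ₁₂ y
  have a₁₃ := h.away_or_away hγ₁ hγ₃ (x₁.trans x₃.symm) γ₁₃ y
  have a₂₃ := h.away_or_away hγ₂ hγ₃ (x₂.trans x₃.symm) γ₂₃ y
  have b₁₂ := h.away_or_away hδ₁ hδ₂ (y₁.trans y₂.symm) δ₁₂ x
  have b₁₃ := h.away_or_away hδ₁ hδ₃ (y₁.trans y₃.symm) δ₁₃ x
  have b₂₃ := h.away_or_away hδ₂ hδ₃ (y₂.trans y₃.symm) δ₂₃ x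
  have key : ∀ {γ δ : ℝ → X}, IsRayMap γ → IsRayMap δ → γ 0 = x → δ 0 = y → Asymptotic γ δ →
      (∀ s, 0 ≤ s → dist y (γ s) = dist y (γ 0) + s) →
      (∀ s, 0 ≤ s → dist x (δ s) = dist x (δ 0) + s) → x = y := by
    rintro γ δ hγ hδ rfl rfl has h1 h2
    exact has.eq_of_away hγ hδ h1 h2
  have k₁ := key hγ₁ hδ₁ x₁ y₁ as₁
  have k₂ := key hγ₂ hδ₂ x₂ y₂ as₂
  have k₃ := key hγ₃ hδ₃ x₃ y₃ as₃
  clear * - a₁₂ a₁₃ a₂₃ b₁₂ b₁₃ b₂₃ k₁ k₂ k₃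
  tauto

theorem IsRTree.finite_branchPoints (h : IsRTree X) (hfin : {e : Set (Set X) | IsEnd e}.Finite) :
    {x : X | IsBranchPoint x}.Finite := by
  have := hfin.to_subtype
  have hbr : ∀ x : {x : X | IsBranchPoint x}, _ := fun x => isBranchPoint_iff.1 x.2
  choose γ₁ γ₂ γ₃ h1 h2 h3 h12 h13 h23 using hbr
  let f : {x : X | IsBranchPoint x} → {e : Set (Set X) | IsEnd e} ×
      {e : Set (Set X) | IsEnd e} × {e : Set (Set X) | IsEnd e} := fun x =>
    (⟨_, (h1 x).1.isEnd⟩, ⟨_, (h2 x).1.isEnd⟩, ⟨_, (h3 x).1.isEnd⟩)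
  refine Set.finite_coe_iff.1 (Finite.of_injective f fun x y hxy => ?_)
  simp only [f, Prod.mk.injEq, Subtype.mk.injEq] at hxy
  obtain ⟨e1, e2, e3⟩ := hxy
  exact Subtype.ext (h.tripod_center_eq (h1 x).1 (h2 x).1 (h3 x).1 (h1 y).1 (h2 y).1 (h3 y).1
    (h1 x).2 (h2 x).2 (h3 x).2 (h1 y).2 (h2 y).2 (h3 y).2 (h12 x) (h13 x) (h23 x)
    (h12 y) (h13 y) (h23 y) ((h.rayEnd_eq_iff (h1 x).1 (h1 y).1).1 e1)
    ((h.rayEnd_eq_iff (h2 x).1 (h2 y).1).1 e2) ((h.rayEnd_eq_iff (h3 x).1 (h3 y).1).1 e3))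

theorem IsRTree.exists_ray_in_end (h : IsRTree X) {e : Set (Set X)} (he : IsEnd e) (x : X) :
    ∃ γ, IsRayMap γ ∧ γ 0 = x ∧ e = rayEnd γ := by
  obtain ⟨δ, hδ, rfl⟩ := isEnd_iff.1 he
  obtain ⟨γ, hγ, h0, has⟩ := h.exists_asymptotic_from hδ x
  exact ⟨γ, hγ, h0, (h.rayEnd_eq_iff hδ hγ).2 has.symm⟩

/-- Two distinct ends are joined by a line. -/
theorem IsRTree.exists_opposite_rays (h : IsRTree X) {e e' : Set (Set X)} (he : IsEnd e)
    (he' : IsEnd e') (hne : e ≠ e') : ∃ γ δ, IsRayMap γ ∧ IsRayMap δ ∧ γ 0 = δ 0 ∧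
      e = rayEnd γ ∧ e' = rayEnd δ ∧ ∀ u, 0 < u → γ u ≠ δ u := by
  obtain ⟨γ, hγ, rfl⟩ := isEnd_iff.1 he
  obtain ⟨δ, hδ, hδ0, rfl⟩ := h.exists_ray_in_end he' (γ 0)
  have hex : ∃ c, 0 ≤ c ∧ γ c ≠ δ c := by
    by_contra! hcon
    exact hne ((h.rayEnd_eq_iff hγ hδ).2 ⟨0, 0, le_rfl, le_rfl, fun s hs => by
      simpa using hcon s hs⟩)
  obtain ⟨c, hc, hce⟩ := hex
  obtain ⟨t, ht, hte, htmax⟩ := exists_last_agreement hc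
    (fun u hu v hv => hγ u hu.1 v hv.1) (fun u hu v hv => hδ u hu.1 v hv.1) hδ0.symm
  refine ⟨fun s => γ (t + s), fun s => δ (t + s), hγ.shift ht.1, hδ.shift ht.1, by simpa using hte,
    (h.rayEnd_eq_iff hγ (hγ.shift ht.1)).2 ⟨t, 0, ht.1, le_rfl, fun s _ => by simp⟩,
    (h.rayEnd_eq_iff hδ (hδ.shift ht.1)).2 ⟨t, 0, ht.1, le_rfl, fun s _ => by simp⟩,
    fun v hv he => ?_⟩
  rcases le_total (t + v) c with hle | hle
  · linarith [htmax (t + v) ⟨by linarith [ht.1], hle⟩ he]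
  · exact hce (h.ray_agree hγ hδ hδ0.symm he hc hle)

theorem IsRTree.exists_branchPoint (h : IsRTree X) (h3 : AtLeastThreeEnds X) :
    ∃ x : X, IsBranchPoint x := by
  obtain ⟨e₁, e₂, e₃, he₁, he₂, he₃, h12, h13, h23⟩ := h3
  obtain ⟨γ₁, γ₂, hγ₁, hγ₂, h0, rfl, rfl, hne⟩ := h.exists_opposite_rays he₁ he₂ h12
  obtain ⟨γ₃, hγ₃, hγ0, rfl⟩ := h.exists_ray_in_end he₃ (γ₁ 0)
  have hdiff : ∀ {γ : ℝ → X}, IsRayMap γ → rayEnd γ ≠ rayEnd γ₃ → ∃ c, 0 ≤ c ∧ γ c ≠ γ₃ c := by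
    intro γ hγ hn
    by_contra! hcon
    exact hn ((h.rayEnd_eq_iff hγ hγ₃).2 ⟨0, 0, le_rfl, le_rfl, fun s hs => by
      simpa using hcon s hs⟩)
  by_cases hA : ∃ u, 0 < u ∧ γ₁ u = γ₃ u
  · obtain ⟨u, hu, hue⟩ := hA
    obtain ⟨c, hc, hce⟩ := hdiff hγ₁ h13
    obtain ⟨t, -, ht⟩ := h.exists_branchPoint_of_diverge hγ₁ hγ₃ hγ₂ hγ0.symm h0 hu hue hc hce hne
    exact ⟨_, ht⟩
  by_cases hB : ∃ u, 0 < u ∧ γ₂ u = γ₃ u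
  · obtain ⟨u, hu, hue⟩ := hB
    obtain ⟨c, hc, hce⟩ := hdiff hγ₂ h23
    obtain ⟨t, -, ht⟩ := h.exists_branchPoint_of_diverge hγ₂ hγ₃ hγ₁ (h0.symm.trans hγ0.symm)
      h0.symm hu hue hc hce fun u hu => (hne u hu).symm
    exact ⟨_, ht⟩
  push Not at hA hB
  exact ⟨γ₁ 0, isBranchPoint_iff.2 ⟨γ₁, γ₂, γ₃, ⟨hγ₁, rfl⟩, ⟨hγ₂, h0.symm⟩, ⟨hγ₃, hγ0⟩,
    hne, hA, hB⟩⟩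

theorem IsRTree.finite_ends (h : IsRTree X) (hlf : LocallyFiniteTree X) {x : X}
    (hx : IsBranchPoint x) (huniq : ∀ y : X, IsBranchPoint y → y = x) :
    {e : Set (Set X) | IsEnd e}.Finite := by
  obtain ⟨γ₁, γ₂, γ₃, ⟨h1, z1⟩, ⟨h2, z2⟩, -, h12, -⟩ := isBranchPoint_iff.1 hx
  obtain ⟨n, Rs, hRs, hcov⟩ := hlf x
  choose ρ hρ hρ0 hρR using hRs
  have hray : ∀ e : {e : Set (Set X) | IsEnd e}, _ := fun e => h.exists_ray_in_end e.2 x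
  choose γ hγ hγ0 hγe using hray
  have hi : ∀ e, ∃ i, ∃ u, 0 < u ∧ γ e u = ρ i u := by
    intro e
    obtain ⟨i, hi⟩ := hcov _ ⟨γ e, hγ e, hγ0 e, rfl⟩
    rw [hρR i, ← hγ0 e, locCoincide_iff (hγ e) (hρ i) ((hγ0 e).trans (hρ0 i).symm)] at hi
    exact ⟨i, hi⟩
  choose i u hu hui using hi
  refine Set.finite_coe_iff.1 (Finite.of_injective i fun e e' hee => Subtype.ext ?_)
  have h0 : γ e 0 = γ e' 0 := (hγ0 e).trans (hγ0 e').symm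
  rw [hγe e, hγe e', h.rayEnd_eq_iff (hγ e) (hγ e')]
  by_contra hcon
  have hex : ∃ c, 0 ≤ c ∧ γ e c ≠ γ e' c := by
    by_contra! hall
    exact hcon ⟨0, 0, le_rfl, le_rfl, fun s hs => by simpa using hall s hs⟩
  obtain ⟨c, hc, hce⟩ := hex
  have hm : 0 < min (u e) (u e') := lt_min (hu e) (hu e')
  have hag : γ e (min (u e) (u e')) = γ e' (min (u e) (u e')) := by
    rw [h.ray_agree (hγ e) (hρ _) ((hγ0 e).trans (hρ0 _).symm) (hui e) hm.le (min_le_left _ _),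
      h.ray_agree (hγ e') (hρ _) ((hγ0 e').trans (hρ0 _).symm) (hui e') hm.le (min_le_right _ _),
      hee]
  have hother : ∃ δ : ℝ → X, IsRayMap δ ∧ δ 0 = x ∧ ∀ u, 0 < u → γ e u ≠ δ u := by
    by_cases hA : ∃ v, 0 < v ∧ γ e v = γ₁ v
    · obtain ⟨v, hv, hve⟩ := hA
      refine ⟨γ₂, h2, z2, fun w hw he => ?_⟩
      have hm : 0 < min v w := lt_min hv hw
      apply h12 _ hm
      rw [← h.ray_agree (hγ e) h1 ((hγ0 e).trans z1.symm) hve hm.le (min_le_left _ _),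
        ← h.ray_agree (hγ e) h2 ((hγ0 e).trans z2.symm) he hm.le (min_le_right _ _)]
    · push Not at hA
      exact ⟨γ₁, h1, z1, hA⟩
  obtain ⟨δ, hδ, hδ0, hne⟩ := hother
  obtain ⟨t, ht, hbr⟩ := h.exists_branchPoint_of_diverge (hγ e) (hγ e') hδ h0
    ((hγ0 e).trans hδ0.symm) hm hag hc hce hne
  have e1 := (hγ e).dist_zero ht.le
  rw [huniq _ hbr, hγ0, dist_self] at e1
  linarith

/-- A segment `[x, y]` that extends at both ends to rays `γ`, `δ` is contained in every line with
the same two ends. -/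
theorem IsRTree.mem_line (h : IsRTree X) {α β γ δ : ℝ → X} (hα : IsRayMap α) (hβ : IsRayMap β)
    (hαβ0 : α 0 = β 0) (hαβ : ∀ u, 0 < u → α u ≠ β u) (hγ : IsRayMap γ) (hδ : IsRayMap δ)
    (hne : γ 0 ≠ δ 0) (hγδ : ∀ s, 0 ≤ s → dist (δ 0) (γ s) = dist (δ 0) (γ 0) + s)
    (hδγ : ∀ s, 0 ≤ s → dist (γ 0) (δ s) = dist (γ 0) (δ 0) + s)
    (h1 : Asymptotic α γ) (h2 : Asymptotic β δ) :
    ∀ p, (p = γ 0 ∨ p = δ 0) → ∃ s, 0 ≤ s ∧ (p = α s ∨ p = β s) := by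
  obtain ⟨a, a', ha, ha', h1⟩ := h1
  obtain ⟨b, b', hb, hb', h2⟩ := h2
  have e1 := h1 0 le_rfl
  have e2 := h2 0 le_rfl
  simp only [add_zero] at e1 e2
  have l1 := hγδ a' ha'
  have l2 := hδγ b' hb'
  have d1 := hγ.dist_zero ha'
  have d2 := hδ.dist_zero hb'
  have c1 := dist_comm (γ a') (γ 0)
  have c2 := dist_comm (δ 0) (γ a')
  have c3 := dist_comm (δ 0) (γ 0)
  have tot := h.dist_eq_of_overlap (p := γ a') (q := δ b') hne (by linarith) (by linarith)
  have opp := h.dist_opposite hα hβ hαβ0 hαβ ha hb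
  rw [e1, e2] at opp
  intro p hp
  have hbt : dist (α a) p + dist p (β b) = dist (α a) (β b) := by
    rw [e1, e2]
    rcases hp with rfl | rfl <;> linarith
  rw [e1, e2, opp] at hbt
  have q1 : 0 ≤ dist (γ a') p := dist_nonneg
  have q2 : 0 ≤ dist p (δ b') := dist_nonneg
  rcases le_total (dist (γ a') p) a with hle | hle
  · refine ⟨a - dist (γ a') p, by linarith, Or.inl ?_⟩
    have f1 := hα.dist_eq (show 0 ≤ a - dist (γ a') p by linarith)
      (show a - dist (γ a') p ≤ a by linarith)
    have f2 := h.dist_opposite hα hβ hαβ0 hαβ (show 0 ≤ a - dist (γ a') p by linarith) hb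
    rw [e1, dist_comm] at f1
    rw [e2] at f2
    exact h.eq_of_between (x := γ a') (y := δ b') (by linarith) (by linarith) (by linarith)
  · refine ⟨dist (γ a') p - a, by linarith, Or.inr ?_⟩
    have f1 := hβ.dist_eq (show 0 ≤ dist (γ a') p - a by linarith)
      (show dist (γ a') p - a ≤ b by linarith)
    have f2 := h.dist_opposite hα hβ hαβ0 hαβ ha (show 0 ≤ dist (γ a') p - a by linarith)
    rw [e2] at f1
    rw [e1] at f2
    exact h.eq_of_between (x := γ a') (y := δ b') (by linarith) (by linarith) (by linarith)

theorem IsRTree.asymptotic_of_pushEnd (h : IsRTree X) {γ δ : ℝ → X} (hγ : IsRayMap γ)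
    (hδ : IsRayMap δ) {g : X → X} (hg : Isometry g) (he : pushEnd g (rayEnd γ) = rayEnd δ) :
    Asymptotic (fun s => g (γ s)) δ := by
  rw [← h.mem_rayEnd_iff (hγ.comp_isometry hg) hδ, ← he]
  exact ⟨γ '' Set.Ici 0, (h.mem_rayEnd_iff hγ hγ).2 (Asymptotic.refl γ), Set.image_image ..⟩

/-- Among three rays leaving `x` in different directions, two lead away from `y`. -/
theorem IsBranchPoint.exists_two_away (h : IsRTree X) {x : X} (hx : IsBranchPoint x) (y : X) :
    ∃ γ δ : ℝ → X, IsRayMap γ ∧ IsRayMap δ ∧ γ 0 = x ∧ δ 0 = x ∧ (∀ u, 0 < u → γ u ≠ δ u) ∧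
      (∀ s, 0 ≤ s → dist y (γ s) = dist y x + s) ∧
      (∀ s, 0 ≤ s → dist y (δ s) = dist y x + s) := by
  obtain ⟨γ₁, γ₂, γ₃, ⟨h1, z1⟩, ⟨h2, z2⟩, ⟨h3, z3⟩, h12, h13, h23⟩ := isBranchPoint_iff.1 hx
  have a₁₂ := h.away_or_away h1 h2 (z1.trans z2.symm) h12 y
  have a₁₃ := h.away_or_away h1 h3 (z1.trans z3.symm) h13 y
  have a₂₃ := h.away_or_away h2 h3 (z2.trans z3.symm) h23 y
  rw [z1, z2] at a₁₂
  rw [z1, z3] at a₁₃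
  rw [z2, z3] at a₂₃
  rcases a₁₂ with a | a
  · rcases a₂₃ with b | b
    · exact ⟨γ₁, γ₂, h1, h2, z1, z2, h12, a, b⟩
    · exact ⟨γ₁, γ₃, h1, h3, z1, z3, h13, a, b⟩
  · rcases a₁₃ with b | b
    · exact ⟨γ₁, γ₂, h1, h2, z1, z2, h12, b, a⟩
    · exact ⟨γ₂, γ₃, h2, h3, z2, z3, h23, a, b⟩

theorem IsRTree.branchPoint_unique (h : IsRTree X)
    (h2trans : ∀ a b a' b' : Set (Set X), IsEnd a → IsEnd b → IsEnd a' → IsEnd b' →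
      a ≠ b → a' ≠ b' → ∃ g : X ≃ᵢ X, pushEnd g a = a' ∧ pushEnd g b = b')
    (hfin : {e : Set (Set X) | IsEnd e}.Finite) {p q : X} (hp : IsBranchPoint p)
    (hq : IsBranchPoint q) : p = q := by
  have hB := h.finite_branchPoints hfin
  obtain ⟨⟨x, y⟩, ⟨hx, hy⟩, hmax⟩ := Set.exists_max_image _ (fun z : X × X => dist z.1 z.2)
    (hB.prod hB) ⟨(p, q), hp, hq⟩
  by_contra hpq
  have hxy : x ≠ y := dist_pos.1 ((dist_pos.2 hpq).trans_le (hmax (p, q) ⟨hp, hq⟩))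
  obtain ⟨α, β, hα, hβ, hα0, hβ0, hαβ, hαy, hβy⟩ := IsBranchPoint.exists_two_away h hx y
  obtain ⟨δ, -, hδ, -, rfl, -, -, hδx, -⟩ := IsBranchPoint.exists_two_away h hy x
  have hend : ∀ {γ δ : ℝ → X}, IsRayMap γ → IsRayMap δ → γ 0 = δ 0 →
      (∀ u, 0 < u → γ u ≠ δ u) → rayEnd γ ≠ rayEnd δ := by
    intro γ δ hγ hδ h0 hne he
    exact hne 1 one_pos
      (h.eq_of_asymptotic hγ hδ h0 ((h.rayEnd_eq_iff hγ hδ).1 he) zero_le_one)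
  subst hα0
  have hαδ : rayEnd α ≠ rayEnd δ := fun he =>
    hxy (((h.rayEnd_eq_iff hα hδ).1 he).eq_of_away hα hδ hαy hδx)
  obtain ⟨g, hg1, hg2⟩ := h2trans _ _ _ _ hα.isEnd hβ.isEnd hα.isEnd hδ.isEnd
    (hend hα hβ hβ0.symm hαβ) hαδ
  have hline := h.mem_line (hα.comp_isometry g.isometry) (hβ.comp_isometry g.isometry)
    (congrArg g hβ0.symm) (fun u hu => g.injective.ne (hαβ u hu)) hα hδ hxy hαy hδx
    (h.asymptotic_of_pushEnd hα hα g.isometry hg1) (h.asymptotic_of_pushEnd hβ hδ g.isometry hg2)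
  -- the line formed by `α` and `β` meets the set of branch points in `α 0` only
  have honly : ∀ z, IsBranchPoint z → (z = α 0 ∨ z = δ 0) → z = g (α 0) := by
    intro z hz hz'
    obtain ⟨s, hs, he⟩ := hline z hz'
    have hbr := hz.map_isometry g.symm.isometry
    have hm := hmax (δ 0, g.symm z) ⟨hy, hbr⟩
    simp only [dist_comm (α 0) (δ 0)] at hm
    rcases he with rfl | rfl
    · rw [g.symm_apply_apply, hαy s hs] at hm
      rw [show s = 0 by linarith]
    · rw [g.symm_apply_apply, hβy s hs] at hm
      rw [show s = 0 by linarith, hβ0]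
  exact hxy ((honly _ hx (Or.inl rfl)).trans (honly _ hy (Or.inr rfl)).symm)

end Ends

theorem single_branch_point_iff_finitely_many_ends {X : Type*} [MetricSpace X]
    (htree : IsRTree X) (hleaf : Leafless X) (hlf : LocallyFiniteTree X)
    (hends : AtLeastThreeEnds X) (G : Subgroup (X ≃ᵢ X))
    (h2trans : ∀ a b a' b' : Set (Set X), IsEnd a → IsEnd b → IsEnd a' → IsEnd b' →
      a ≠ b → a' ≠ b' → ∃ g ∈ G, pushEnd (⇑g) a = a' ∧ pushEnd (⇑g) b = b') :
    (∃! x : X, IsBranchPoint x) ↔ {e : Set (Set X) | IsEnd e}.Finite := by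
  constructor
  · rintro ⟨x, hx, huniq⟩
    exact htree.finite_ends hlf hx huniq
  · intro hfin
    obtain ⟨x, hx⟩ := htree.exists_branchPoint hends
    refine ⟨x, hx, fun y hy => htree.branchPoint_unique ?_ hfin hy hx⟩
    intro a b a' b' ha hb ha' hb' hab hab'
    obtain ⟨g, -, hg⟩ := h2trans a b a' b' ha hb ha' hb' hab hab'
    exact ⟨g, hg⟩
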